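/- arXiv:2211.15567 — 3 statements merged into one kernel-verified Lean document; each statement's English description precedes it below -/
import Mathlib

section
/- Let n ≥ 1, 0 < p < ∞ and δ > 0, and let a = (a_j)_{j∈ℤ} ⊂ ℝ and b = (b_j)_{j∈ℤ} ⊂ (0,∞) satisfy A := ∑_{j∈ℤ} 2^{δ|j|} |a_j| b_j^{-1/p} < ∞. Then there is a constant C = C(p, δ) > 0, independent of n, a, b, such that for every Lebesgue-measurable f : ℝ^n → ℝ with ∫_{{x_n > 0}} |f(x)|^p dx < ∞, the series ∑_{j∈ℤ} a_j f(x', -b_j x_n) converges absolutely for almost every x = (x', x_n) with x_n < 0, and (∫_{ℝ^n} |E^{a,b}f(x)|^p dx)^{1/p} ≤ C · (1 + A) · (∫_{{x_n > 0}} |f(x)|^p dx)^{1/p}. -/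
open MeasureTheory

/-- The half-space extension `E^{a,b}`: points of ℝ^n are written as pairs
`(x', xₙ) ∈ ℝ^{n-1} × ℝ`; `Eext a b f (x', xₙ) = f (x', xₙ)` for `xₙ ≥ 0` and
`= ∑_{j∈ℤ} a_j f(x', -b_j xₙ)` for `xₙ < 0`. -/
noncomputable def Eext {P : Type*} (a b : ℤ → ℝ) (f : P × ℝ → ℝ) : P × ℝ → ℝ :=
  fun x => if 0 ≤ x.2 then f x else ∑' j : ℤ, a j * f (x.1, -(b j) * x.2)

open scoped ENNReal

lemma summable_two_rpow_neg_mul_abs_int {s : ℝ} (hs : 0 < s) :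
    Summable fun j : ℤ => (2 : ℝ) ^ (-(s * |(j : ℝ)|)) := by
  have key : Summable fun n : ℕ => (2 : ℝ) ^ (-(s * (n : ℝ))) := by
    have hr : (2 : ℝ) ^ (-s) < 1 := Real.rpow_lt_one_of_one_lt_of_neg one_lt_two (by linarith)
    refine (summable_geometric_of_lt_one (by positivity) hr).congr fun n => ?_
    rw [← Real.rpow_natCast, ← Real.rpow_mul zero_le_two, neg_mul]
  refine Summable.of_nat_of_neg ?_ ?_ <;> simpa using key

/-- A weighted substitute for Minkowski's inequality, valid for every `p > 0`. -/
lemma ENNReal.tsum_rpow_le_mul_tsum_rpow {ι : Type*} {p : ℝ} (hp : 0 < p) (w G : ι → ℝ≥0∞)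
    (hw0 : ∀ j, w j ≠ 0) (hw : ∀ j, w j ≠ ∞) :
    (∑' j, G j) ^ p ≤ (∑' j, (w j)⁻¹) ^ p * ∑' j, (w j * G j) ^ p := by
  set T := ∑' j, (w j * G j) ^ p
  have hG : ∀ j, G j ≤ (w j)⁻¹ * T ^ (1 / p) := fun j => by
    have h1 : w j * G j ≤ T ^ (1 / p) := by
      rw [one_div, ENNReal.le_rpow_inv_iff hp]
      exact ENNReal.le_tsum j
    calc G j = (w j)⁻¹ * (w j * G j) := by
          rw [← mul_assoc, ENNReal.inv_mul_cancel (hw0 j) (hw j), one_mul]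
      _ ≤ _ := by gcongr
  calc (∑' j, G j) ^ p ≤ (∑' j, (w j)⁻¹ * T ^ (1 / p)) ^ p := by
        gcongr with j
        exact hG j
    _ = _ := by
        rw [ENNReal.tsum_mul_right, ENNReal.mul_rpow_of_nonneg _ _ hp.le, ← ENNReal.rpow_mul,
          one_div_mul_cancel hp.ne', ENNReal.rpow_one]

lemma lintegral_comp_snd_mul {P : Type*} [MeasureSpace P] [SFinite (volume : Measure P)]
    {c : ℝ} (hc : c ≠ 0) {h : P × ℝ → ℝ≥0∞} (hh : Measurable h) :
    ∫⁻ x : P × ℝ, h (x.1, c * x.2) = ENNReal.ofReal |c⁻¹| * ∫⁻ x, h x := by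
  rw [Measure.volume_eq_prod, lintegral_prod _ (by fun_prop), lintegral_prod _ (by fun_prop),
    ← lintegral_const_mul _ hh.lintegral_prod_right']
  refine lintegral_congr fun x => ?_
  have hx : Measurable fun y => h (x, y) := by fun_prop
  rw [← lintegral_map (f := fun y => h (x, y)) hx (measurable_const_mul c),
    Real.map_volume_mul_left hc, lintegral_smul_measure, smul_eq_mul]

lemma setLIntegral_comp_snd_neg_mul {P : Type*} [MeasureSpace P] [SFinite (volume : Measure P)]
    {b : ℝ} (hb : 0 < b) {h : P × ℝ → ℝ≥0∞} (hh : Measurable h) :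
    ∫⁻ x in {x : P × ℝ | x.2 < 0}, h (x.1, -b * x.2) =
      ENNReal.ofReal b⁻¹ * ∫⁻ x in {x : P × ℝ | 0 < x.2}, h x := by
  have hpos : MeasurableSet {x : P × ℝ | 0 < x.2} := measurableSet_lt measurable_const measurable_snd
  have hneg : MeasurableSet {x : P × ℝ | x.2 < 0} := measurableSet_lt measurable_snd measurable_const
  rw [← lintegral_indicator hpos, ← lintegral_indicator hneg]
  have := lintegral_comp_snd_mul (neg_ne_zero.2 hb.ne') (hh.indicator hpos)
  rw [inv_neg, abs_neg, abs_of_pos (inv_pos.2 hb)] at this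
  rw [← this]
  refine lintegral_congr fun x => ?_
  simp only [Set.indicator, Set.mem_ofPred_eq]
  congr 1
  rw [neg_mul, neg_pos, mul_neg_iff]
  simp [hb, hb.not_gt]

/-- The `L^p` quasi-norm bound for the sum of reflected and dilated copies of `f`. -/
lemma lintegral_tsum_enorm_rpow_le {P : Type*} [MeasureSpace P] [SFinite (volume : Measure P)]
    {p δ : ℝ} (hp : 0 < p) {a b : ℤ → ℝ} (hb : ∀ j, 0 < b j)
    (hA : Summable fun j : ℤ => (2 : ℝ) ^ (δ * |(j : ℝ)|) * |a j| * b j ^ (-1 / p))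
    {f : P × ℝ → ℝ} (hf : Measurable f) :
    ∫⁻ x in {x : P × ℝ | x.2 < 0}, (∑' j, ‖a j * f (x.1, -(b j) * x.2)‖ₑ) ^ p ≤
      (∑' j : ℤ, ENNReal.ofReal ((2 : ℝ) ^ (-(δ / 2 * |(j : ℝ)|)))) ^ p *
        (∑' j : ℤ, ENNReal.ofReal ((2 : ℝ) ^ (-(p * δ / 2 * |(j : ℝ)|)))) *
        (ENNReal.ofReal (∑' j : ℤ, (2 : ℝ) ^ (δ * |(j : ℝ)|) * |a j| * b j ^ (-1 / p))) ^ p *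
        ∫⁻ x in {x : P × ℝ | 0 < x.2}, ‖f x‖ₑ ^ p := by
  set N := ∫⁻ x in {x : P × ℝ | 0 < x.2}, ‖f x‖ₑ ^ p
  set A := ∑' j : ℤ, (2 : ℝ) ^ (δ * |(j : ℝ)|) * |a j| * b j ^ (-1 / p)
  let w : ℤ → ℝ := fun j => (2 : ℝ) ^ (δ / 2 * |(j : ℝ)|)
  have hw : ∀ j, 0 < w j := fun j => by positivity
  have hterm : ∀ j : ℤ, (2 : ℝ) ^ (δ * |(j : ℝ)|) * |a j| * b j ^ (-1 / p) ≤ A := fun j =>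
    hA.le_tsum j fun i _ => by have := hb i; positivity
  have hcoef : ∀ j : ℤ, (w j * |a j|) ^ p * (b j)⁻¹ ≤
      (2 : ℝ) ^ (-(p * δ / 2 * |(j : ℝ)|)) * A ^ p := fun j => by
    have hbj := hb j
    have hwa : w j * |a j| * b j ^ (-1 / p) =
        (2 : ℝ) ^ (-(δ / 2 * |(j : ℝ)|)) *
          ((2 : ℝ) ^ (δ * |(j : ℝ)|) * |a j| * b j ^ (-1 / p)) := by
      simp only [w, ← mul_assoc]
      rw [← Real.rpow_add zero_lt_two]
      ring_nf
    calc (w j * |a j|) ^ p * (b j)⁻¹ = (w j * |a j| * b j ^ (-1 / p)) ^ p := by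
          rw [Real.mul_rpow (mul_nonneg (hw j).le (abs_nonneg _)) (by positivity),
            ← Real.rpow_mul hbj.le, div_mul_cancel₀ _ hp.ne', Real.rpow_neg_one]
      _ ≤ ((2 : ℝ) ^ (-(δ / 2 * |(j : ℝ)|)) * A) ^ p := by
          rw [hwa]
          gcongr
          exact hterm j
      _ = _ := by
          have hA0 : 0 ≤ A := le_trans (by positivity) (hterm j)
          rw [Real.mul_rpow (by positivity) hA0, ← Real.rpow_mul zero_le_two]
          ring_nf
  have hint : ∀ j, ∫⁻ x in {x : P × ℝ | x.2 < 0},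
      (ENNReal.ofReal (w j) * ‖a j * f (x.1, -(b j) * x.2)‖ₑ) ^ p ≤
      ENNReal.ofReal ((2 : ℝ) ^ (-(p * δ / 2 * |(j : ℝ)|))) * ENNReal.ofReal A ^ p * N := fun j => by
    have hA0 : 0 ≤ A := le_trans (by have := hb j; positivity) (hterm j)
    have hwa : 0 ≤ w j * |a j| := mul_nonneg (hw j).le (abs_nonneg _)
    calc _ = ∫⁻ x in {x : P × ℝ | x.2 < 0},
          ENNReal.ofReal ((w j * |a j|) ^ p) * ‖f (x.1, -(b j) * x.2)‖ₑ ^ p := by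
          refine lintegral_congr fun x => ?_
          rw [enorm_mul, ← mul_assoc, Real.enorm_eq_ofReal_abs (a j),
            ← ENNReal.ofReal_mul (hw j).le, ENNReal.mul_rpow_of_nonneg _ _ hp.le,
            ENNReal.ofReal_rpow_of_nonneg hwa hp.le]
      _ = ENNReal.ofReal ((w j * |a j|) ^ p * (b j)⁻¹) * N := by
          rw [lintegral_const_mul _ (by fun_prop),
            setLIntegral_comp_snd_neg_mul (hb j) (h := fun x => ‖f x‖ₑ ^ p) (by fun_prop),
            ← mul_assoc, ← ENNReal.ofReal_mul (by positivity)]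
      _ ≤ _ := by
          rw [ENNReal.ofReal_rpow_of_nonneg hA0 hp.le, ← ENNReal.ofReal_mul (by positivity)]
          gcongr ?_ * N
          exact ENNReal.ofReal_le_ofReal (hcoef j)
  have hinv : ∀ j : ℤ, (ENNReal.ofReal (w j))⁻¹ =
      ENNReal.ofReal ((2 : ℝ) ^ (-(δ / 2 * |(j : ℝ)|))) := fun j => by
    rw [← ENNReal.ofReal_inv_of_pos (hw j), Real.rpow_neg zero_le_two]
  calc _ ≤ ∫⁻ x in {x : P × ℝ | x.2 < 0},
        (∑' j, (ENNReal.ofReal (w j))⁻¹) ^ p *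
          ∑' j, (ENNReal.ofReal (w j) * ‖a j * f (x.1, -(b j) * x.2)‖ₑ) ^ p :=
        lintegral_mono fun x => ENNReal.tsum_rpow_le_mul_tsum_rpow hp _ _
          (fun j => (ENNReal.ofReal_pos.2 (hw j)).ne') fun j => ENNReal.ofReal_ne_top
    _ = (∑' j, (ENNReal.ofReal (w j))⁻¹) ^ p * ∑' j, ∫⁻ x in {x : P × ℝ | x.2 < 0},
          (ENNReal.ofReal (w j) * ‖a j * f (x.1, -(b j) * x.2)‖ₑ) ^ p := by
        rw [lintegral_const_mul _ (Measurable.tsum fun j => by fun_prop),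
          lintegral_tsum fun j => by fun_prop]
    _ ≤ (∑' j, (ENNReal.ofReal (w j))⁻¹) ^ p * ∑' j : ℤ,
          ENNReal.ofReal ((2 : ℝ) ^ (-(p * δ / 2 * |(j : ℝ)|))) * ENNReal.ofReal A ^ p * N := by
        gcongr with j
        exact hint j
    _ = _ := by
        simp_rw [ENNReal.tsum_mul_right, hinv]
        ring

/-- for 0 < p < ∞ and δ > 0 there is C = C(p,δ) > 0, independent of the
dimension and of the sequences a, b with A := ∑_j 2^{δ|j|}|a_j| b_j^{-1/p} < ∞, such
that for every measurable f with ∫_{xₙ>0} |f|^p < ∞, the defining series of E^{a,b}f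
converges absolutely a.e. on {xₙ < 0} and
‖E^{a,b}f‖_{L^p(ℝ^n)} ≤ C (1 + A) ‖f‖_{L^p(ℝ^n_+)}. -/
theorem statement12 (p δ : ℝ) (hp : 0 < p) (hδ : 0 < δ) :
    ∃ C : ℝ, 0 < C ∧
      ∀ (m : ℕ) (a b : ℤ → ℝ), (∀ j, 0 < b j) →
        Summable (fun j : ℤ => (2 : ℝ) ^ (δ * |(j : ℝ)|) * |a j| * b j ^ (-1 / p)) →
        ∀ f : (Fin m → ℝ) × ℝ → ℝ, Measurable f →
          (∫⁻ x in {x : (Fin m → ℝ) × ℝ | 0 < x.2}, ENNReal.ofReal (|f x| ^ p)) < ⊤ →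
          (∀ᵐ x : (Fin m → ℝ) × ℝ, x.2 < 0 →
            Summable (fun j : ℤ => |a j * f (x.1, -(b j) * x.2)|)) ∧
          (∫⁻ x : (Fin m → ℝ) × ℝ, ENNReal.ofReal (|Eext a b f x| ^ p)) ^ (1 / p) ≤
            ENNReal.ofReal
              (C * (1 + ∑' j : ℤ, (2 : ℝ) ^ (δ * |(j : ℝ)|) * |a j| * b j ^ (-1 / p))) *
            (∫⁻ x in {x : (Fin m → ℝ) × ℝ | 0 < x.2}, ENNReal.ofReal (|f x| ^ p)) ^ (1 / p) := by
  set K₁ := ∑' j : ℤ, ENNReal.ofReal ((2 : ℝ) ^ (-(δ / 2 * |(j : ℝ)|))) with hK₁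
  set K₂ := ∑' j : ℤ, ENNReal.ofReal ((2 : ℝ) ^ (-(p * δ / 2 * |(j : ℝ)|))) with hK₂
  have hK₁t : K₁ ≠ ∞ := (summable_two_rpow_neg_mul_abs_int (by positivity)).tsum_ofReal_ne_top
  have hK₂t : K₂ ≠ ∞ := (summable_two_rpow_neg_mul_abs_int (by positivity)).tsum_ofReal_ne_top
  set D := (1 + K₁ ^ p * K₂) ^ (1 / p) with hD
  have hDt : D ≠ ∞ := ENNReal.rpow_ne_top_of_nonneg (by positivity)
    (ENNReal.add_ne_top.2 ⟨ENNReal.one_ne_top,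
      ENNReal.mul_ne_top (ENNReal.rpow_ne_top_of_nonneg hp.le hK₁t) hK₂t⟩)
  have hD0 : D ≠ 0 := by simp [hD, hp.le]
  refine ⟨D.toReal, ENNReal.toReal_pos hD0 hDt, fun m a b hb hA f hf hN => ?_⟩
  have hfp : ∀ y : ℝ, ENNReal.ofReal (|y| ^ p) = ‖y‖ₑ ^ p := fun y => by
    rw [Real.enorm_eq_ofReal_abs, ENNReal.ofReal_rpow_of_nonneg (abs_nonneg _) hp.le]
  simp only [hfp] at hN ⊢
  have hmain := lintegral_tsum_enorm_rpow_le hp hb hA hf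
  set A := ∑' j : ℤ, (2 : ℝ) ^ (δ * |(j : ℝ)|) * |a j| * b j ^ (-1 / p)
  set N := ∫⁻ x in {x : (Fin m → ℝ) × ℝ | 0 < x.2}, ‖f x‖ₑ ^ p
  rw [← hK₁, ← hK₂] at hmain
  have hA0 : 0 ≤ A := tsum_nonneg fun i => by have := hb i; positivity
  have hneg : MeasurableSet {x : (Fin m → ℝ) × ℝ | x.2 < 0} :=
    measurableSet_lt measurable_snd measurable_const
  constructor
  · have hfin := ae_lt_top' (Measurable.aemeasurable
      ((Measurable.tsum fun j => by fun_prop).pow_const p)) (hmain.trans_lt (by finiteness)).ne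
    rw [ae_restrict_iff' hneg] at hfin
    filter_upwards [hfin] with x hx hx0
    have hx' : ∑' j, ‖a j * f (x.1, -(b j) * x.2)‖ₑ ≠ ∞ := fun h => by
      have := hx hx0
      rw [h, ENNReal.top_rpow_of_pos hp] at this
      exact this.ne rfl
    exact (ENNReal.summable_toReal hx').congr fun j => by simp
  · have hnn : ∫⁻ x in {x : (Fin m → ℝ) × ℝ | x.2 < 0}ᶜ, ‖Eext a b f x‖ₑ ^ p = N := by
      have hset : ({x : (Fin m → ℝ) × ℝ | x.2 < 0}ᶜ : Set _) =ᵐ[volume]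
          {x : (Fin m → ℝ) × ℝ | 0 < x.2} := by
        have h0 : ∀ᵐ x : (Fin m → ℝ) × ℝ, x.2 ≠ 0 :=
          Measure.quasiMeasurePreserving_snd.ae (Measure.ae_ne volume 0)
        filter_upwards [h0] with x hx
        simp only [eq_iff_iff]
        change ¬ x.2 < 0 ↔ 0 < x.2
        rw [not_lt, le_iff_lt_or_eq, or_iff_left hx.symm]
      rw [setLIntegral_congr hset]
      refine setLIntegral_congr_fun (measurableSet_lt measurable_const measurable_snd) ?_
      intro x hx
      have hx' : 0 ≤ x.2 := le_of_lt hx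
      simp [Eext, hx']
    have hle : ∫⁻ x in {x : (Fin m → ℝ) × ℝ | x.2 < 0}, ‖Eext a b f x‖ₑ ^ p ≤
        K₁ ^ p * K₂ * ENNReal.ofReal A ^ p * N := by
      refine le_trans (setLIntegral_mono' hneg fun x hx => ?_) hmain
      have hx' : ¬ 0 ≤ x.2 := not_le.2 hx
      simp only [Eext, hx', if_false]
      gcongr
      exact enorm_tsum_le_tsum_enorm
    have htotal : ∫⁻ x, ‖Eext a b f x‖ₑ ^ p ≤
        (1 + K₁ ^ p * K₂) * ENNReal.ofReal (1 + A) ^ p * N := by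
      rw [← lintegral_add_compl _ hneg, hnn]
      have h1 : (1 : ℝ≥0∞) ≤ ENNReal.ofReal (1 + A) ^ p :=
        ENNReal.one_le_rpow (by simpa using hA0) hp
      calc _ ≤ K₁ ^ p * K₂ * ENNReal.ofReal (1 + A) ^ p * N
            + 1 * ENNReal.ofReal (1 + A) ^ p * N := by
            gcongr
            · exact hle.trans (by gcongr; linarith)
            · simpa using mul_le_mul_left h1 N
        _ = _ := by ring
    calc _ ≤ ((1 + K₁ ^ p * K₂) * ENNReal.ofReal (1 + A) ^ p * N) ^ (1 / p) := by gcongr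
      _ = _ := by
        rw [ENNReal.mul_rpow_of_nonneg _ _ (by positivity),
          ENNReal.mul_rpow_of_nonneg _ _ (by positivity), ← ENNReal.rpow_mul,
          mul_one_div_cancel hp.ne', ENNReal.rpow_one,
          ENNReal.ofReal_mul ENNReal.toReal_nonneg, ENNReal.ofReal_toReal hDt]
end

section
/- Let n ≥ 1, k ∈ ℕ, and let a = (a_j)_{j∈ℤ} ⊂ ℝ and b = (b_j)_{j∈ℤ} ⊂ (0,∞) satisfy ∑_{j∈ℤ} |a_j| (1 + b_j^k) < ∞ and ∑_{j∈ℤ} a_j (-b_j)^m = 1 for every integer 0 ≤ m ≤ k. Let f : ℝ^n → ℝ be of class C^k with all partial derivatives of order ≤ k bounded on ℝ^n. Then E^{a,b}f (which depends only on the values of f on {x_n ≥ 0}) is of class C^k on all of ℝ^n; for every multi-index γ with |γ| ≤ k and every x with x_n < 0 one has ∂^γ(E^{a,b}f)(x) = ∑_{j∈ℤ} a_j (-b_j)^{γ_n} (∂^γ f)(x', -b_j x_n); and sup_{x∈ℝ^n} |∂^γ(E^{a,b}f)(x)| ≤ (∑_{j∈ℤ} |a_j|(1 + b_j^k)) ·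 sup_{x_n ≥ 0} |∂^γ f(x)| for every |γ| ≤ k. -/
/-- Directional (partial) derivative in the direction `v`. -/
noncomputable def pd {E : Type*} [NormedAddCommGroup E] [NormedSpace ℝ E]
    (v : E) (f : E → ℝ) : E → ℝ :=
  fun x => fderiv ℝ f x v

/-- The `i`-th standard basis vector of ℝ^n = ℝ^{n-1} × ℝ (the last one being the
`xₙ` direction). -/
noncomputable def basisVec (m : ℕ) (i : Fin (m + 1)) : (Fin m → ℝ) × ℝ :=
  if h : (i : ℕ) < m then (Pi.single ⟨(i : ℕ), h⟩ 1, 0) else (0, 1)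

/-- The iterated partial derivative `∂^γ` associated with a multi-index
`γ : Fin (m+1) → ℕ` (the last component `γ (Fin.last m)` is `γₙ`). -/
noncomputable def multiPD {m : ℕ} (γ : Fin (m + 1) → ℕ)
    (f : (Fin m → ℝ) × ℝ → ℝ) : (Fin m → ℝ) × ℝ → ℝ :=
  ((List.ofFn (fun i : Fin (m + 1) => (pd (basisVec m i))^[γ i])).foldr (· ∘ ·) id) f

/-- Iterated partial derivatives along a list of coordinate indices, the last one applied first. -/
noncomputable def iterPD {m : ℕ} (L : List (Fin (m + 1)))
    (f : (Fin m → ℝ) × ℝ → ℝ) : (Fin m → ℝ) × ℝ → ℝ :=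
  L.foldr (fun i g => pd (basisVec m i) g) f

/-- The index list in which `i` occurs `γ i` times, in increasing order. -/
def indexList {m : ℕ} (γ : Fin (m + 1) → ℕ) : List (Fin (m + 1)) :=
  (List.finRange (m + 1)).flatMap fun i => List.replicate (γ i) i

/-- The factor by which the dilation `(x', xₙ) ↦ (x', -t xₙ)` multiplies the `i`-th basis vector. -/
def dilationWeight {m : ℕ} (t : ℝ) (i : Fin (m + 1)) : ℝ :=
  if i = Fin.last m then -t else 1

/-- The hypotheses of order `k` on the coefficients of the extension. -/
def AdmissibleCoeffs (b : ℤ → ℝ) (k : ℕ) (a : ℤ → ℝ) : Prop :=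
  Summable (fun j => |a j| * (1 + b j ^ k)) ∧
    ∀ l ≤ k, HasSum (fun j => a j * (-(b j)) ^ l) 1

/-- `f` is of class `C^k` and its iterated partial derivatives of order at most `k` are bounded. -/
def BoundedContDiff {m : ℕ} (k : ℕ) (f : (Fin m → ℝ) × ℝ → ℝ) : Prop :=
  ContDiff ℝ k f ∧ ∀ L : List (Fin (m + 1)), L.length ≤ k → ∃ M, ∀ x, |iterPD L f x| ≤ M

section PartialDerivatives

lemma contDiff_pd {E : Type*} [NormedAddCommGroup E] [NormedSpace ℝ E] {k : ℕ} {f : E → ℝ}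
    (hf : ContDiff ℝ (k + 1 : ℕ) f) (v : E) : ContDiff ℝ k (pd v f) :=
  (hf.fderiv_right (by norm_cast)).clm_apply contDiff_const

lemma pd_comm {E : Type*} [NormedAddCommGroup E] [NormedSpace ℝ E] {f : E → ℝ}
    (hf : ContDiff ℝ 2 f) (v w : E) : pd v (pd w f) = pd w (pd v f) := by
  have hd : Differentiable ℝ (fderiv ℝ f) :=
    (hf.fderiv_right (m := 1) (by norm_num)).differentiable one_ne_zero
  have key (v w x : E) : pd v (pd w f) x = fderiv ℝ (fderiv ℝ f) x v w := by
    have h := (hd x).hasFDerivAt.clm_apply (hasFDerivAt_const w x)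
    change fderiv ℝ (fun y => fderiv ℝ f y w) x v = _
    rw [h.fderiv]
    simp
  funext x
  rw [key, key]
  exact (hf.contDiffAt.isSymmSndFDerivAt (by simp)).eq v w

variable {m : ℕ}

lemma contDiff_iterPD (L : List (Fin (m + 1))) {k : ℕ} {f : (Fin m → ℝ) × ℝ → ℝ}
    (hf : ContDiff ℝ (k + L.length : ℕ) f) : ContDiff ℝ k (iterPD L f) := by
  induction L generalizing k with
  | nil => simpa [iterPD] using hf
  | cons i L ih =>
    refine contDiff_pd (ih ?_) _
    rwa [List.length_cons, ← Nat.add_assoc, Nat.add_right_comm] at hf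

lemma iterPD_eq_of_perm {L L' : List (Fin (m + 1))} (h : L.Perm L')
    {f : (Fin m → ℝ) × ℝ → ℝ} (hf : ContDiff ℝ L.length f) : iterPD L f = iterPD L' f := by
  induction h with
  | nil => rfl
  | cons i h ih => exact congrArg _ (ih (hf.of_le (by simp)))
  | swap i j L =>
    refine pd_comm (contDiff_iterPD (k := 2) L ?_) _ _
    rwa [List.length_cons, List.length_cons, Nat.add_assoc, Nat.add_comm] at hf
  | trans h₁ h₂ ih₁ ih₂ => exact (ih₁ hf).trans (ih₂ (by rwa [← h₁.length_eq]))

lemma iterPD_concat (L : List (Fin (m + 1))) (i : Fin (m + 1)) (f : (Fin m → ℝ) × ℝ → ℝ) :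
    iterPD (L ++ [i]) f = iterPD L (pd (basisVec m i) f) := by
  simp [iterPD]

lemma iterPD_append (L L' : List (Fin (m + 1))) (f : (Fin m → ℝ) × ℝ → ℝ) :
    iterPD (L ++ L') f = iterPD L (iterPD L' f) := by
  simp [iterPD]

lemma iterPD_replicate (n : ℕ) (i : Fin (m + 1)) (f : (Fin m → ℝ) × ℝ → ℝ) :
    iterPD (List.replicate n i) f = (pd (basisVec m i))^[n] f := by
  induction n with
  | zero => rfl
  | succ n ih =>
    rw [Function.iterate_succ_apply', ← ih]
    rfl

lemma multiPD_eq_iterPD (γ : Fin (m + 1) → ℕ) (f : (Fin m → ℝ) × ℝ → ℝ) :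
    multiPD γ f = iterPD (indexList γ) f := by
  rw [multiPD, indexList, List.ofFn_eq_map]
  induction List.finRange (m + 1) with
  | nil => rfl
  | cons i L ih =>
    simp only [List.map_cons, List.foldr_cons, Function.comp_apply, List.flatMap_cons,
      iterPD_append, iterPD_replicate, ih]

lemma count_indexList (γ : Fin (m + 1) → ℕ) (i : Fin (m + 1)) : (indexList γ).count i = γ i := by
  rw [indexList, List.count_flatMap, ← List.ofFn_eq_map, List.sum_ofFn]
  simp [List.count_replicate]

lemma length_indexList (γ : Fin (m + 1) → ℕ) : (indexList γ).length = ∑ i, γ i := by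
  rw [indexList, List.length_flatMap, ← List.ofFn_eq_map, List.sum_ofFn]
  simp

lemma boundedContDiff_of_multiPD {k : ℕ} {f : (Fin m → ℝ) × ℝ → ℝ} (hf : ContDiff ℝ k f)
    (hfb : ∀ γ : Fin (m + 1) → ℕ, (∑ i, γ i) ≤ k → ∃ M : ℝ, ∀ x, |multiPD γ f x| ≤ M) :
    BoundedContDiff k f := by
  refine ⟨hf, fun L hL => ?_⟩
  have hp : L.Perm (indexList fun i => L.count i) :=
    List.perm_iff_count.2 fun i => (count_indexList (fun i => L.count i) i).symm
  obtain ⟨M, hM⟩ := hfb (fun i => L.count i) (by rwa [← length_indexList, ← hp.length_eq])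
  refine ⟨M, fun x => ?_⟩
  rw [iterPD_eq_of_perm hp (hf.of_le (by exact_mod_cast hL)), ← multiPD_eq_iterPD]
  exact hM x

lemma BoundedContDiff.pd_basisVec {k : ℕ} {f : (Fin m → ℝ) × ℝ → ℝ} (hf : BoundedContDiff (k + 1) f)
    (i : Fin (m + 1)) : BoundedContDiff k (pd (basisVec m i) f) := by
  refine ⟨contDiff_pd hf.1 _, fun L hL => ?_⟩
  rw [← iterPD_concat]
  exact hf.2 _ (by simpa using hL)

lemma BoundedContDiff.bounded {k : ℕ} {f : (Fin m → ℝ) × ℝ → ℝ} (hf : BoundedContDiff k f) :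
    ∃ M, ∀ x, |f x| ≤ M :=
  hf.2 [] (Nat.zero_le k)

lemma basisVec_castSucc (i : Fin m) : basisVec m i.castSucc = (Pi.single i 1, 0) := by
  simp [basisVec]

lemma basisVec_last : basisVec m (Fin.last m) = (0, 1) := by
  simp [basisVec]

lemma sum_smul_basisVec (v : (Fin m → ℝ) × ℝ) :
    ∑ i : Fin m, v.1 i • basisVec m i.castSucc + v.2 • basisVec m (Fin.last m) = v := by
  simp only [basisVec_castSucc, basisVec_last]
  refine Prod.ext ?_ ?_
  · funext l
    simp [Prod.fst_sum, Finset.sum_apply, Pi.single_apply]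
  · simp [Prod.snd_sum]

lemma opNorm_le_sum_basisVec (A : (Fin m → ℝ) × ℝ →L[ℝ] ℝ) :
    ‖A‖ ≤ ∑ i, |A (basisVec m i)| := by
  refine A.opNorm_le_bound (Finset.sum_nonneg fun _ _ => abs_nonneg _) fun v => ?_
  conv_lhs => rw [← sum_smul_basisVec v]
  rw [Fin.sum_univ_castSucc, add_mul, Finset.sum_mul, map_add, map_sum]
  refine (norm_add_le _ _).trans (add_le_add ((norm_sum_le _ _).trans ?_) ?_)
  · refine Finset.sum_le_sum fun i _ => ?_
    rw [map_smul, norm_smul, mul_comm, Real.norm_eq_abs (A _)]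
    gcongr
    exact (norm_le_pi_norm v.1 i).trans (norm_fst_le v)
  · rw [map_smul, norm_smul, mul_comm, Real.norm_eq_abs (A _)]
    gcongr
    exact norm_snd_le v

lemma BoundedContDiff.fderiv_bounded {k : ℕ} {f : (Fin m → ℝ) × ℝ → ℝ}
    (hf : BoundedContDiff (k + 1) f) : ∃ M, ∀ x, ‖fderiv ℝ f x‖ ≤ M := by
  choose M hM using fun i => (hf.pd_basisVec i).bounded
  exact ⟨∑ i, M i, fun x => (opNorm_le_sum_basisVec _).trans
    (Finset.sum_le_sum fun i _ => hM i x)⟩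

lemma contDiff_succ_of_pd {k : ℕ} {f : (Fin m → ℝ) × ℝ → ℝ} (hf : Differentiable ℝ f)
    (h : ∀ i, ContDiff ℝ k (pd (basisVec m i) f)) : ContDiff ℝ (k + 1 : ℕ) f := by
  push_cast
  refine contDiff_succ_iff_fderiv.2 ⟨hf, by simp, contDiff_clm_apply_iff.2 fun v => ?_⟩
  conv => enter [3, x]; rw [← sum_smul_basisVec v]
  simp only [map_add, map_sum, map_smul]
  exact (ContDiff.sum fun i _ => (h _).const_smul _).add ((h _).const_smul _)

end PartialDerivatives

section Coefficients

lemma pow_le_one_add_pow {t : ℝ} (ht : 0 ≤ t) {l k : ℕ} (h : l ≤ k) : t ^ l ≤ 1 + t ^ k := by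
  rcases le_total t 1 with ht₁ | ht₁
  · exact (pow_le_one₀ ht ht₁).trans (le_add_of_nonneg_right (pow_nonneg ht _))
  · exact (pow_le_pow_right₀ ht₁ h).trans (le_add_of_nonneg_left zero_le_one)

variable {b : ℤ → ℝ} {a : ℤ → ℝ} {k : ℕ}

lemma AdmissibleCoeffs.summable_pow (hb : ∀ j, 0 < b j) (ha : AdmissibleCoeffs b k a) {l : ℕ}
    (hl : l ≤ k) : Summable fun j => |a j| * b j ^ l := by
  refine ha.1.of_nonneg_of_le (fun j => mul_nonneg (abs_nonneg _) (pow_nonneg (hb j).le _))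
    fun j => ?_
  gcongr
  exact pow_le_one_add_pow (hb j).le hl

lemma AdmissibleCoeffs.summable_abs (hb : ∀ j, 0 < b j) (ha : AdmissibleCoeffs b k a) :
    Summable fun j => |a j| := by
  simpa using ha.summable_pow hb (Nat.zero_le k)

lemma AdmissibleCoeffs.hasSum (ha : AdmissibleCoeffs b k a) : HasSum a 1 := by
  simpa using ha.2 0 (Nat.zero_le k)

lemma AdmissibleCoeffs.mul_dilationWeight (hb : ∀ j, 0 < b j) (ha : AdmissibleCoeffs b (k + 1) a)
    {m : ℕ} (i : Fin (m + 1)) : AdmissibleCoeffs b k fun j => a j * dilationWeight (b j) i := by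
  by_cases hi : i = Fin.last m
  · simp only [dilationWeight, hi, if_true]
    refine ⟨((ha.summable_pow hb (l := 1) (by simp)).add
      (ha.summable_pow hb le_rfl)).congr fun j => ?_, fun l hl => ?_⟩
    · rw [abs_mul, abs_neg, abs_of_pos (hb j)]
      ring
    · simpa only [pow_succ', mul_assoc] using ha.2 (l + 1) (by lia)
  · simp only [dilationWeight, hi, if_false, mul_one]
    refine ⟨((ha.summable_abs hb).add (ha.summable_pow hb k.le_succ)).congr fun j => ?_,
      fun l hl => ha.2 l (by lia)⟩
    ring

end Coefficients

section Extension

variable {m : ℕ}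

/-- The dilation `(x', xₙ) ↦ (x', -t xₙ)`. -/
noncomputable def dilation (m : ℕ) (t : ℝ) : (Fin m → ℝ) × ℝ →L[ℝ] (Fin m → ℝ) × ℝ :=
  (ContinuousLinearMap.fst ℝ (Fin m → ℝ) ℝ).prod (-t • ContinuousLinearMap.snd ℝ (Fin m → ℝ) ℝ)

lemma dilation_apply (t : ℝ) (x : (Fin m → ℝ) × ℝ) : dilation m t x = (x.1, -t * x.2) := rfl

lemma dilation_eq_self (t : ℝ) {x : (Fin m → ℝ) × ℝ} (hx : x.2 = 0) : dilation m t x = x := by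
  rw [dilation_apply, hx, mul_zero, ← hx]

lemma dilation_basisVec (t : ℝ) (i : Fin (m + 1)) :
    dilation m t (basisVec m i) = dilationWeight t i • basisVec m i := by
  induction i using Fin.lastCases with
  | last => simp [dilation_apply, basisVec_last, dilationWeight]
  | cast i => simp [dilation_apply, basisVec_castSucc, dilationWeight, Fin.castSucc_ne_last]

lemma norm_dilation_le {t : ℝ} (ht : 0 < t) : ‖dilation m t‖ ≤ 1 + t := by
  refine (dilation m t).opNorm_le_bound (by positivity) fun x => ?_
  rw [dilation_apply]
  refine norm_prod_le_iff.2 ⟨?_, ?_⟩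
  · exact (norm_fst_le x).trans (le_mul_of_one_le_left (norm_nonneg x) (by linarith))
  · rw [norm_mul, norm_neg, Real.norm_of_nonneg ht.le]
    exact mul_le_mul (by linarith) (norm_snd_le x) (norm_nonneg _) (by linarith)

variable {k : ℕ} {a b : ℤ → ℝ} {f : (Fin m → ℝ) × ℝ → ℝ}

lemma Eext_of_nonneg {x : (Fin m → ℝ) × ℝ} (hx : 0 ≤ x.2) : Eext a b f x = f x :=
  if_pos hx

lemma Eext_of_neg {x : (Fin m → ℝ) × ℝ} (hx : x.2 < 0) :
    Eext a b f x = ∑' j, a j * f (dilation m (b j) x) :=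
  if_neg hx.not_ge

lemma tsum_dilation_of_snd_eq_zero (ha : HasSum a 1) {x : (Fin m → ℝ) × ℝ} (hx : x.2 = 0) :
    ∑' j, a j * f (dilation m (b j) x) = f x := by
  simp only [dilation_eq_self _ hx, tsum_mul_right, ha.tsum_eq, one_mul]

lemma Eext_of_nonpos (ha : HasSum a 1) {x : (Fin m → ℝ) × ℝ} (hx : x.2 ≤ 0) :
    Eext a b f x = ∑' j, a j * f (dilation m (b j) x) := by
  rcases hx.lt_or_eq with h | h
  · exact Eext_of_neg h
  · rw [Eext_of_nonneg h.ge, tsum_dilation_of_snd_eq_zero ha h]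

lemma norm_mul_dilation_le {M : ℝ} (hM : ∀ x, |f x| ≤ M) (j : ℤ) (x : (Fin m → ℝ) × ℝ) :
    ‖a j * f (dilation m (b j) x)‖ ≤ |a j| * M := by
  rw [norm_mul, Real.norm_eq_abs, Real.norm_eq_abs]
  exact mul_le_mul_of_nonneg_left (hM _) (abs_nonneg _)

lemma continuous_Eext (hb : ∀ j, 0 < b j) (ha : AdmissibleCoeffs b k a)
    (hf : BoundedContDiff k f) : Continuous (Eext a b f) := by
  obtain ⟨M, hM⟩ := hf.bounded
  have hc := hf.1.continuous
  have hg : Continuous fun x => ∑' j, a j * f (dilation m (b j) x) :=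
    continuous_tsum (fun j => by fun_prop) ((ha.summable_abs hb).mul_right M)
      (norm_mul_dilation_le hM)
  exact Continuous.if_le hc hg continuous_const continuous_snd fun x hx =>
    (tsum_dilation_of_snd_eq_zero ha.hasSum hx.symm).symm

lemma summable_smul_fderiv_comp_dilation (hb : ∀ j, 0 < b j) (ha : AdmissibleCoeffs b (k + 1) a)
    {M : ℝ} (hM : ∀ x, ‖fderiv ℝ f x‖ ≤ M) :
    Summable (fun j => |a j| * (M * (1 + b j))) ∧ ∀ j x,
      ‖a j • (fderiv ℝ f (dilation m (b j) x)).comp (dilation m (b j))‖ ≤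
        |a j| * (M * (1 + b j)) := by
  refine ⟨(((ha.summable_abs hb).add (ha.summable_pow hb (l := 1) (by simp))).mul_left M).congr
    fun j => by ring, fun j x => ?_⟩
  rw [norm_smul, Real.norm_eq_abs]
  refine mul_le_mul_of_nonneg_left ((ContinuousLinearMap.opNorm_comp_le _ _).trans ?_)
    (abs_nonneg _)
  exact mul_le_mul (hM _) (norm_dilation_le (hb j)) (norm_nonneg _)
    ((norm_nonneg _).trans (hM 0))

/-- The derivative of the extension at a point of the lower half-space. -/
noncomputable def reflectedFDeriv (a b : ℤ → ℝ) (f : (Fin m → ℝ) × ℝ → ℝ)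
    (x : (Fin m → ℝ) × ℝ) : (Fin m → ℝ) × ℝ →L[ℝ] ℝ :=
  ∑' j, a j • (fderiv ℝ f (dilation m (b j) x)).comp (dilation m (b j))

lemma reflectedFDeriv_basisVec (hb : ∀ j, 0 < b j) (ha : AdmissibleCoeffs b (k + 1) a)
    (hf : BoundedContDiff (k + 1) f) (x : (Fin m → ℝ) × ℝ) (i : Fin (m + 1)) :
    reflectedFDeriv a b f x (basisVec m i) =
      ∑' j, a j * dilationWeight (b j) i * pd (basisVec m i) f (dilation m (b j) x) := by
  obtain ⟨M, hM⟩ := hf.fderiv_bounded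
  obtain ⟨hs, hle⟩ := summable_smul_fderiv_comp_dilation hb ha hM
  have h : Summable fun j => a j • (fderiv ℝ f (dilation m (b j) x)).comp (dilation m (b j)) :=
    .of_norm_bounded hs fun j => hle j x
  rw [reflectedFDeriv, ← ContinuousLinearMap.apply_apply (𝕜 := ℝ) (basisVec m i),
    ContinuousLinearMap.map_tsum _ h]
  refine tsum_congr fun j => ?_
  simp [dilation_basisVec, pd, mul_assoc]

lemma clm_ext_basisVec {A B : (Fin m → ℝ) × ℝ →L[ℝ] ℝ}
    (h : ∀ i, A (basisVec m i) = B (basisVec m i)) : A = B := by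
  refine ContinuousLinearMap.ext fun v => ?_
  rw [← sum_smul_basisVec v]
  simp only [map_add, map_sum, map_smul, h]

lemma reflectedFDeriv_of_snd_eq_zero (hb : ∀ j, 0 < b j) (ha : AdmissibleCoeffs b (k + 1) a)
    (hf : BoundedContDiff (k + 1) f) {x : (Fin m → ℝ) × ℝ} (hx : x.2 = 0) :
    reflectedFDeriv a b f x = fderiv ℝ f x :=
  clm_ext_basisVec fun i => by
    rw [reflectedFDeriv_basisVec hb ha hf]
    exact tsum_dilation_of_snd_eq_zero (ha.mul_dilationWeight hb i).hasSum hx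

lemma hasFDerivAt_Eext (hb : ∀ j, 0 < b j) (ha : AdmissibleCoeffs b (k + 1) a)
    (hf : BoundedContDiff (k + 1) f) (x : (Fin m → ℝ) × ℝ) :
    HasFDerivAt (Eext a b f)
      (if 0 ≤ x.2 then fderiv ℝ f x else reflectedFDeriv a b f x) x := by
  have hd : Differentiable ℝ f := hf.1.differentiable (by simp)
  obtain ⟨M₀, hM₀⟩ := hf.bounded
  obtain ⟨M, hM⟩ := hf.fderiv_bounded
  obtain ⟨hs, hle⟩ := summable_smul_fderiv_comp_dilation hb ha hM
  have hg : HasFDerivAt (fun y => ∑' j, a j * f (dilation m (b j) y))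
      (reflectedFDeriv a b f x) x := by
    refine hasFDerivAt_tsum (x₀ := 0) hs (fun j y => ?_) hle
      (.of_norm_bounded ((ha.summable_abs hb).mul_right M₀)
        fun j => norm_mul_dilation_le hM₀ j 0) x
    exact ((hd _).hasFDerivAt.comp y (dilation m (b j)).hasFDerivAt).const_mul (a j)
  rcases lt_trichotomy x.2 0 with hx | hx | hx
  · rw [if_neg hx.not_ge]
    refine hg.congr_of_eventuallyEq ?_
    filter_upwards [continuous_snd.continuousAt.eventually_lt_const hx] with y hy
      using Eext_of_neg hy
  · rw [if_pos hx.ge]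
    have hpos : HasFDerivWithinAt (Eext a b f) (fderiv ℝ f x) {y | 0 ≤ y.2} x :=
      (hd x).hasFDerivAt.hasFDerivWithinAt.congr (fun y hy => Eext_of_nonneg hy)
        (Eext_of_nonneg hx.ge)
    have hneg : HasFDerivWithinAt (Eext a b f) (fderiv ℝ f x) {y | y.2 ≤ 0} x := by
      rw [reflectedFDeriv_of_snd_eq_zero hb ha hf hx] at hg
      exact hg.hasFDerivWithinAt.congr (fun y hy => Eext_of_nonpos ha.hasSum hy)
        (Eext_of_nonpos ha.hasSum hx.le)
    refine (hpos.union hneg).hasFDerivAt ?_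
    exact Filter.mem_of_superset Filter.univ_mem fun y _ => le_total 0 y.2
  · rw [if_pos hx.le]
    refine (hd x).hasFDerivAt.congr_of_eventuallyEq ?_
    filter_upwards [continuous_snd.continuousAt.eventually_const_lt hx] with y hy
      using Eext_of_nonneg hy.le

lemma pd_Eext (hb : ∀ j, 0 < b j) (ha : AdmissibleCoeffs b (k + 1) a)
    (hf : BoundedContDiff (k + 1) f) (i : Fin (m + 1)) :
    pd (basisVec m i) (Eext a b f) =
      Eext (fun j => a j * dilationWeight (b j) i) b (pd (basisVec m i) f) := by
  funext x
  rw [pd, (hasFDerivAt_Eext hb ha hf x).fderiv]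
  split_ifs with hx
  · rw [Eext_of_nonneg hx, pd]
  · rw [Eext_of_neg (not_le.1 hx), reflectedFDeriv_basisVec hb ha hf]

lemma contDiff_Eext (hb : ∀ j, 0 < b j) (ha : AdmissibleCoeffs b k a)
    (hf : BoundedContDiff k f) : ContDiff ℝ k (Eext a b f) := by
  induction k generalizing a f with
  | zero => exact contDiff_zero.2 (continuous_Eext hb ha hf)
  | succ k ih =>
    refine contDiff_succ_of_pd (fun x => (hasFDerivAt_Eext hb ha hf x).differentiableAt) fun i => ?_
    rw [pd_Eext hb ha hf]
    exact ih (ha.mul_dilationWeight hb i) (hf.pd_basisVec i)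

lemma iterPD_Eext (hb : ∀ j, 0 < b j) (L : List (Fin (m + 1))) (hL : L.length ≤ k)
    (ha : AdmissibleCoeffs b k a) (hf : BoundedContDiff k f) :
    iterPD L (Eext a b f) =
      Eext (fun j => a j * (-(b j)) ^ L.count (Fin.last m)) b (iterPD L f) := by
  induction L using List.reverseRecOn generalizing k a f with
  | nil => simp [iterPD]
  | append_singleton L i ih =>
    obtain ⟨k, rfl⟩ : ∃ l, k = l + 1 := ⟨k - 1, by simp at hL; lia⟩
    rw [iterPD_concat, iterPD_concat, pd_Eext hb ha hf,
      ih (by simpa using hL) (ha.mul_dilationWeight hb i) (hf.pd_basisVec i)]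
    congr 1
    funext j
    by_cases hi : i = Fin.last m
    · simp [dilationWeight, hi, pow_succ']
      ring
    · simp [dilationWeight, hi]

lemma multiPD_Eext (hb : ∀ j, 0 < b j) (ha : AdmissibleCoeffs b k a) (hf : BoundedContDiff k f)
    {γ : Fin (m + 1) → ℕ} (hγ : ∑ i, γ i ≤ k) :
    multiPD γ (Eext a b f) =
      Eext (fun j => a j * (-(b j)) ^ γ (Fin.last m)) b (multiPD γ f) := by
  rw [multiPD_eq_iterPD, multiPD_eq_iterPD,
    iterPD_Eext hb _ (by rwa [length_indexList]) ha hf, count_indexList]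

/-- The extension is bounded by the values on the upper half-space. -/
lemma abs_Eext_le (hb : ∀ j, 0 < b j) {c : ℤ → ℝ} (hc : Summable c)
    (hac : ∀ j, |a j| ≤ c j) (ha : HasSum a 1) {M : ℝ} (hM : ∀ x, 0 ≤ x.2 → |f x| ≤ M)
    (x : (Fin m → ℝ) × ℝ) : |Eext a b f x| ≤ (∑' j, c j) * M := by
  have hM₀ : 0 ≤ M := (abs_nonneg _).trans (hM 0 le_rfl)
  rcases le_or_gt 0 x.2 with hx | hx
  · rw [Eext_of_nonneg hx]
    refine (hM x hx).trans (le_mul_of_one_le_left hM₀ ?_)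
    exact hasSum_le (fun j => (le_abs_self _).trans (hac j)) ha hc.hasSum
  · rw [Eext_of_neg hx]
    rw [← Real.norm_eq_abs]
    refine tsum_of_norm_bounded (hc.hasSum.mul_right M) fun j => ?_
    rw [norm_mul]
    refine mul_le_mul (hac j) (hM _ ?_) (norm_nonneg _) ((abs_nonneg _).trans (hac j))
    rw [dilation_apply]
    exact (mul_pos_of_neg_of_neg (neg_neg_of_pos (hb j)) hx).le

end Extension

/-- let k ∈ ℕ, ∑_j |a_j|(1 + b_j^k) < ∞ and ∑_j a_j(-b_j)^m = 1 for all
0 ≤ m ≤ k (b_j > 0). If f is C^k with all partial derivatives of order ≤ k bounded,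
then E^{a,b}f is C^k on ℝ^n; for |γ| ≤ k and xₙ < 0 one has
∂^γ(E^{a,b}f)(x) = ∑_j a_j(-b_j)^{γₙ}(∂^γ f)(x', -b_j xₙ); and
sup |∂^γ(E^{a,b}f)| ≤ (∑_j |a_j|(1 + b_j^k)) · sup_{xₙ≥0} |∂^γ f| for all |γ| ≤ k. -/
theorem statement16 (m k : ℕ) (a b : ℤ → ℝ) (hb : ∀ j, 0 < b j)
    (hsum : Summable (fun j : ℤ => |a j| * (1 + b j ^ k)))
    (hmom : ∀ l : ℕ, l ≤ k → HasSum (fun j : ℤ => a j * (-(b j)) ^ l) 1)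
    (f : (Fin m → ℝ) × ℝ → ℝ) (hf : ContDiff ℝ (k : ℕ∞) f)
    (hfb : ∀ γ : Fin (m + 1) → ℕ, (∑ i, γ i) ≤ k →
      ∃ M : ℝ, ∀ x : (Fin m → ℝ) × ℝ, |multiPD γ f x| ≤ M) :
    ContDiff ℝ (k : ℕ∞) (Eext a b f) ∧
    (∀ γ : Fin (m + 1) → ℕ, (∑ i, γ i) ≤ k →
      ∀ x : (Fin m → ℝ) × ℝ, x.2 < 0 →
        multiPD γ (Eext a b f) x =
          ∑' j : ℤ, a j * (-(b j)) ^ (γ (Fin.last m)) * multiPD γ f (x.1, -(b j) * x.2)) ∧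
    (∀ γ : Fin (m + 1) → ℕ, (∑ i, γ i) ≤ k →
      ∀ x : (Fin m → ℝ) × ℝ,
        |multiPD γ (Eext a b f) x| ≤
          (∑' j : ℤ, |a j| * (1 + b j ^ k)) *
            ⨆ y : {y : (Fin m → ℝ) × ℝ // 0 ≤ y.2}, |multiPD γ f y|) := by
  have ha : AdmissibleCoeffs b k a := ⟨hsum, hmom⟩
  have hF : BoundedContDiff k f := boundedContDiff_of_multiPD hf hfb
  refine ⟨contDiff_Eext hb ha hF, fun γ hγ x hx => ?_, fun γ hγ x => ?_⟩
  · rw [multiPD_Eext hb ha hF hγ, Eext_of_neg hx]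
    rfl
  · have hlast : γ (Fin.last m) ≤ k :=
      (Finset.single_le_sum (fun i _ => Nat.zero_le (γ i)) (Finset.mem_univ _)).trans hγ
    obtain ⟨M, hM⟩ := hfb γ hγ
    have hbdd : BddAbove (Set.range fun y : {y : (Fin m → ℝ) × ℝ // 0 ≤ y.2} =>
        |multiPD γ f y|) := ⟨M, by rintro _ ⟨y, rfl⟩; exact hM y⟩
    rw [multiPD_Eext hb ha hF hγ]
    refine abs_Eext_le hb hsum (fun j => ?_) (hmom _ hlast)
      (fun y hy => le_ciSup hbdd ⟨y, hy⟩) x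
    rw [abs_mul, abs_pow, abs_neg, abs_of_pos (hb j)]
    exact mul_le_mul_of_nonneg_left (pow_le_one_add_pow (hb j).le hlast) (abs_nonneg _)
end

section
/- Let n ≥ 1 and let a = (a_j)_{j∈ℤ} ⊂ ℝ and b = (b_j)_{j∈ℤ} ⊂ (0,∞) satisfy ∑_{j∈ℤ} |a_j| < ∞ and ∑_{j∈ℤ} |a_j| b_j^{-1} < ∞. Let f ∈ L^1(ℝ^n) vanish almost everywhere on {x : x_n < 0}, and let g : ℝ^n → ℝ be bounded and measurable. Then E^{a,b}f is defined almost everywhere and integrable against g, the series below converge absolutely, and ∫_{ℝ^n} E^{a,b}f(x) · g(x) dx = ∫_{{x_n > 0}} f(x) · (g(x) - ∑_{j∈ℤ} (a_j/(-b_j)) g(x', -x_n/b_j)) dx. -/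
open MeasureTheory

/-- A series of integrable functions whose `L¹` norms are summable converges absolutely almost
everywhere. -/
theorem ae_summable_norm_of_summable_integral_norm {ι α E : Type*} [Countable ι]
    [MeasurableSpace α] {μ : Measure α} [NormedAddCommGroup E] {F : ι → α → E}
    (hF : ∀ i, Integrable (F i) μ) (hsum : Summable fun i => ∫ x, ‖F i x‖ ∂μ) :
    ∀ᵐ x ∂μ, Summable fun i => ‖F i x‖ := by
  refine summable_norm_of_tsum_eLpNorm_ne_top le_rfl (fun i => (hF i).1) ?_
  simp_rw [eLpNorm_one_eq_lintegral_enorm, ← ofReal_integral_norm_eq_lintegral_enorm (hF _)]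
  exact hsum.tsum_ofReal_ne_top

/-- The sum of a series of integrable functions whose `L¹` norms are summable is integrable. -/
theorem integrable_tsum_of_summable_integral_norm {ι α E : Type*} [Countable ι]
    [MeasurableSpace α] {μ : Measure α} [NormedAddCommGroup E] [CompleteSpace E] {F : ι → α → E}
    (hF : ∀ i, Integrable (F i) μ) (hsum : Summable fun i => ∫ x, ‖F i x‖ ∂μ) :
    Integrable (fun x => ∑' i, F i x) μ := by
  have hne : ∑' i, ‖(hF i).toL1 (F i)‖ₑ ≠ ⊤ := by
    simp_rw [← ofReal_norm, Integrable.norm_toL1_eq_lintegral_norm,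
      ← integral_eq_lintegral_of_nonneg_ae (Filter.Eventually.of_forall fun _ => norm_nonneg _)
        (hF _).1.norm]
    exact hsum.tsum_ofReal_ne_top
  refine (L1.integrable_coeFn (∑' i, (hF i).toL1 (F i))).congr ?_
  filter_upwards [Lp.coeFn_tsum hne, ae_all_iff.2 fun i => (hF i).coeFn_toL1] with x hx hcoe
  rw [hx]
  exact tsum_congr hcoe

section Scaling

variable {P : Type*} [MeasureSpace P] [SigmaFinite (volume : Measure P)]

theorem measurableEmbedding_prodMk_mul {P : Type*} [MeasurableSpace P] {c : ℝ} (hc : c ≠ 0) :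
    MeasurableEmbedding fun x : P × ℝ => (x.1, c * x.2) :=
  MeasurableEmbedding.id.prodMap (measurableEmbedding_mulLeft₀ hc)

theorem map_volume_prodMk_mul {c : ℝ} (hc : c ≠ 0) :
    (volume : Measure (P × ℝ)).map (fun x => (x.1, c * x.2)) =
      ENNReal.ofReal |c⁻¹| • (volume : Measure (P × ℝ)) := by
  have h := Measure.map_prod_map (volume : Measure P) (volume : Measure ℝ) measurable_id
    (measurable_const_mul c)
  rw [Measure.map_id, Real.map_volume_mul_left hc, Measure.prod_smul_right] at h
  exact h.symm

theorem MeasureTheory.Integrable.comp_prodMk_mul {E : Type*} [NormedAddCommGroup E]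
    {h : P × ℝ → E} (hh : Integrable h) {c : ℝ} (hc : c ≠ 0) :
    Integrable fun x : P × ℝ => h (x.1, c * x.2) := by
  refine (measurableEmbedding_prodMk_mul hc).integrable_map_iff.1 ?_
  rw [map_volume_prodMk_mul hc]
  exact hh.smul_measure ENNReal.ofReal_ne_top

theorem integral_comp_prodMk_mul {E : Type*} [NormedAddCommGroup E] [NormedSpace ℝ E]
    (h : P × ℝ → E) {c : ℝ} (hc : c ≠ 0) :
    ∫ x : P × ℝ, h (x.1, c * x.2) = |c⁻¹| • ∫ x, h x := by
  rw [← (measurableEmbedding_prodMk_mul hc).integral_map h, map_volume_prodMk_mul hc,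
    integral_smul_measure, ENNReal.toReal_ofReal (abs_nonneg _)]

/-- The `j`-th term of `E^{a,b}f · g` on the lower half-space, moved to the upper half-space by the
substitution `y = (x', -b_j xₙ)`. -/
noncomputable def reflectedTerm {P : Type*} (a b : ℤ → ℝ) (f g : P × ℝ → ℝ) (j : ℤ) :
    P × ℝ → ℝ :=
  {y : P × ℝ | 0 < y.2}.indicator fun y => a j * (f y * g (y.1, -y.2 / b j))

theorem measurableSet_snd_pos {P : Type*} [MeasurableSpace P] :
    MeasurableSet {y : P × ℝ | 0 < y.2} :=
  measurableSet_lt measurable_const measurable_snd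

theorem reflectedTerm_comp {P : Type*} {a b : ℤ → ℝ} {j : ℤ} (hb : 0 < b j) (f g : P × ℝ → ℝ)
    (x : P × ℝ) :
    reflectedTerm a b f g j (x.1, -(b j) * x.2) =
      if 0 ≤ x.2 then 0 else a j * f (x.1, -(b j) * x.2) * g x := by
  unfold reflectedTerm
  split_ifs with hx
  · refine Set.indicator_of_notMem ?_ _
    simp only [Set.mem_ofPred_eq, not_lt]
    nlinarith
  · rw [Set.indicator_of_mem]
    · have : -(-(b j) * x.2) / b j = x.2 := by field_simp
      simp only [this, Prod.mk.eta, mul_assoc]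
    · simp only [Set.mem_ofPred_eq]
      nlinarith

variable {a b : ℤ → ℝ} {f g : P × ℝ → ℝ} {M : ℝ}

theorem integrable_mul_comp_reflection {P : Type*} [MeasureSpace P] {f g : P × ℝ → ℝ} {M : ℝ}
    (hf : Integrable f) (hg : Measurable g)
    (hM : ∀ x, |g x| ≤ M) (c : ℝ) : Integrable fun y : P × ℝ => f y * g (y.1, -y.2 / c) := by
  refine hf.mul_bdd (c := M) ?_ (Filter.Eventually.of_forall fun _ => hM _)
  exact (hg.comp (by fun_prop)).aestronglyMeasurable

theorem integrable_reflectedTerm {P : Type*} [MeasureSpace P] {a b : ℤ → ℝ}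
    {f g : P × ℝ → ℝ} {M : ℝ} (hf : Integrable f) (hg : Measurable g)
    (hM : ∀ x, |g x| ≤ M) (j : ℤ) : Integrable (reflectedTerm a b f g j) :=
  ((integrable_mul_comp_reflection hf hg hM _).const_mul _).indicator measurableSet_snd_pos

theorem summable_inv_mul_integral_norm_reflectedTerm {P : Type*} [MeasureSpace P]
    {a b : ℤ → ℝ} {f g : P × ℝ → ℝ} {M : ℝ} (hb : ∀ j, 0 < b j)
    (hab : Summable fun j => |a j| * (b j)⁻¹) (hf : Integrable f) (hg : Measurable g)
    (hM : ∀ x, |g x| ≤ M) :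
    Summable fun j => (b j)⁻¹ * ∫ x, ‖reflectedTerm a b f g j x‖ := by
  refine Summable.of_nonneg_of_le
    (fun j => mul_nonneg (inv_nonneg.2 (hb j).le) (integral_nonneg fun _ => norm_nonneg _))
    (fun j => ?_) (hab.mul_right (∫ x, ‖f x‖ * M))
  rw [mul_comm |a j|, mul_assoc]
  refine mul_le_mul_of_nonneg_left ?_ (inv_nonneg.2 (hb j).le)
  rw [← integral_const_mul]
  refine integral_mono (integrable_reflectedTerm hf hg hM j).norm
    ((hf.norm.mul_const M).const_mul _) fun x => ?_
  refine (norm_indicator_le_norm_self _ _).trans ?_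
  simp only [norm_mul, Real.norm_eq_abs]
  gcongr
  exact hM _

theorem integral_norm_reflectedTerm_comp {j : ℤ} (hb : 0 < b j) :
    ∫ x : P × ℝ, ‖reflectedTerm a b f g j (x.1, -(b j) * x.2)‖ =
      (b j)⁻¹ * ∫ x, ‖reflectedTerm a b f g j x‖ := by
  rw [integral_comp_prodMk_mul (fun x => ‖reflectedTerm a b f g j x‖) (neg_ne_zero.2 hb.ne'),
    inv_neg, abs_neg, abs_of_pos (inv_pos.2 hb), smul_eq_mul]

theorem ae_summable_extension (hb : ∀ j, 0 < b j) (hab : Summable fun j => |a j| * (b j)⁻¹)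
    (hf : Integrable f) :
    ∀ᵐ x : P × ℝ, x.2 < 0 → Summable fun j => |a j * f (x.1, -(b j) * x.2)| := by
  have hM : ∀ x : P × ℝ, |(fun _ => 1 : P × ℝ → ℝ) x| ≤ 1 := by simp
  have hsum := summable_inv_mul_integral_norm_reflectedTerm hb hab hf measurable_const hM
  simp_rw [← integral_norm_reflectedTerm_comp (hb _)] at hsum
  filter_upwards [ae_summable_norm_of_summable_integral_norm (fun j =>
    (integrable_reflectedTerm hf measurable_const hM j).comp_prodMk_mul
      (neg_ne_zero.2 (hb j).ne')) hsum] with x hx hneg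
  simpa only [reflectedTerm_comp (hb _), not_le.2 hneg, if_false, mul_one, Real.norm_eq_abs]
    using hx

theorem Eext_mul_eq {P : Type*} {a b : ℤ → ℝ} (hb : ∀ j, 0 < b j) (f g : P × ℝ → ℝ)
    (x : P × ℝ) :
    Eext a b f x * g x = {y : P × ℝ | 0 ≤ y.2}.indicator (fun y => f y * g y) x +
      ∑' j, reflectedTerm a b f g j (x.1, -(b j) * x.2) := by
  simp only [Eext, reflectedTerm_comp (hb _), Set.indicator_apply, Set.mem_ofPred_eq]
  split_ifs <;> simp [tsum_mul_right]

theorem indicator_mul_sub_tsum_eq {P : Type*} (a b : ℤ → ℝ) (f g : P × ℝ → ℝ) (x : P × ℝ) :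
    {y : P × ℝ | 0 < y.2}.indicator
        (fun y => f y * (g y - ∑' j, a j / (-(b j)) * g (y.1, -y.2 / b j))) x =
      {y : P × ℝ | 0 < y.2}.indicator (fun y => f y * g y) x +
        ∑' j, (b j)⁻¹ * reflectedTerm a b f g j x := by
  simp only [reflectedTerm, Set.indicator_apply, Set.mem_ofPred_eq]
  split_ifs
  · rw [mul_sub, sub_eq_add_neg, ← mul_neg, ← tsum_neg, ← tsum_mul_left]
    congr 1
    refine tsum_congr fun j => ?_
    rw [div_neg, div_eq_mul_inv]
    ring
  · simp

theorem snd_nonneg_ae_eq_snd_pos {P : Type*} [MeasureSpace P] :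
    ({y : P × ℝ | 0 ≤ y.2} : Set (P × ℝ)) =ᵐ[volume] {y : P × ℝ | 0 < y.2} := by
  have h : ∀ᵐ y : P × ℝ, y.2 ≠ 0 :=
    Measure.quasiMeasurePreserving_snd.ae (Measure.ae_ne volume 0)
  filter_upwards [h] with y hy
  exact propext ⟨fun h => lt_of_le_of_ne h hy.symm, le_of_lt⟩

theorem integrable_and_integral_Eext_mul (hb : ∀ j, 0 < b j)
    (hab : Summable fun j => |a j| * (b j)⁻¹) (hf : Integrable f) (hg : Measurable g)
    (hM : ∀ x, |g x| ≤ M) :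
    Integrable (fun x => Eext a b f x * g x) ∧
    ∫ x, Eext a b f x * g x = ∫ x in {x : P × ℝ | 0 < x.2},
      f x * (g x - ∑' j, a j / (-(b j)) * g (x.1, -x.2 / b j)) := by
  have hfg : Integrable fun x => f x * g x :=
    hf.mul_bdd (c := M) hg.aestronglyMeasurable (Filter.Eventually.of_forall hM)
  have hsum := summable_inv_mul_integral_norm_reflectedTerm hb hab hf hg hM
  have hint := integrable_reflectedTerm (a := a) (b := b) hf hg hM
  have hlow : ∀ j, Integrable fun x : P × ℝ =>
      reflectedTerm a b f g j (x.1, -(b j) * x.2) :=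
    fun j => (hint j).comp_prodMk_mul (neg_ne_zero.2 (hb j).ne')
  have hlow_sum : Summable fun j =>
      ∫ x : P × ℝ, ‖reflectedTerm a b f g j (x.1, -(b j) * x.2)‖ := by
    simpa only [integral_norm_reflectedTerm_comp (hb _)] using hsum
  have hup : ∀ j, Integrable fun x => (b j)⁻¹ * reflectedTerm a b f g j x :=
    fun j => (hint j).const_mul _
  have hup_sum : Summable fun j => ∫ x, ‖(b j)⁻¹ * reflectedTerm a b f g j x‖ := by
    simpa only [norm_mul, integral_const_mul, Real.norm_of_nonneg (inv_nonneg.2 (hb _).le)]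
      using hsum
  have hnonneg : MeasurableSet {y : P × ℝ | 0 ≤ y.2} :=
    measurableSet_le measurable_const measurable_snd
  have hlow_tsum := integrable_tsum_of_summable_integral_norm hlow hlow_sum
  have hup_tsum := integrable_tsum_of_summable_integral_norm hup hup_sum
  simp_rw [Eext_mul_eq hb]
  refine ⟨(hfg.indicator hnonneg).add hlow_tsum, ?_⟩
  rw [← integral_indicator measurableSet_snd_pos]
  simp_rw [indicator_mul_sub_tsum_eq]
  rw [integral_add (hfg.indicator hnonneg) hlow_tsum,
    integral_add (hfg.indicator measurableSet_snd_pos) hup_tsum,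
    integral_indicator hnonneg, integral_indicator measurableSet_snd_pos,
    setIntegral_congr_set snd_nonneg_ae_eq_snd_pos,
    ← integral_tsum_of_summable_integral_norm hlow hlow_sum,
    ← integral_tsum_of_summable_integral_norm hup hup_sum]
  congr 1
  refine tsum_congr fun j => ?_
  rw [integral_comp_prodMk_mul _ (neg_ne_zero.2 (hb j).ne'), integral_const_mul, inv_neg, abs_neg,
    abs_of_pos (inv_pos.2 (hb j)), smul_eq_mul]

end Scaling

/-- let ∑_j |a_j| < ∞ and ∑_j |a_j| b_j^{-1} < ∞ (b_j > 0). If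
f ∈ L¹(ℝ^n) vanishes a.e. on {xₙ < 0} and g is bounded and measurable, then the
defining series of E^{a,b}f converges absolutely a.e. on {xₙ < 0}, the series
∑_j (a_j/(-b_j)) g(x', -xₙ/b_j) converges absolutely everywhere, E^{a,b}f · g is
integrable, and
∫ E^{a,b}f·g = ∫_{xₙ>0} f·(g - ∑_j (a_j/(-b_j)) g(x', -xₙ/b_j)). -/
theorem statement19 (m : ℕ) (a b : ℤ → ℝ) (hb : ∀ j, 0 < b j)
    (ha : Summable (fun j : ℤ => |a j|))
    (hab : Summable (fun j : ℤ => |a j| * (b j)⁻¹))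
    (f : (Fin m → ℝ) × ℝ → ℝ) (hf : Integrable f)
    (hf0 : ∀ᵐ x : (Fin m → ℝ) × ℝ, x.2 < 0 → f x = 0)
    (g : (Fin m → ℝ) × ℝ → ℝ) (hg : Measurable g)
    (hgb : ∃ M : ℝ, ∀ x : (Fin m → ℝ) × ℝ, |g x| ≤ M) :
    (∀ᵐ x : (Fin m → ℝ) × ℝ, x.2 < 0 →
      Summable (fun j : ℤ => |a j * f (x.1, -(b j) * x.2)|)) ∧
    (∀ x : (Fin m → ℝ) × ℝ,
      Summable (fun j : ℤ => |a j / (-(b j)) * g (x.1, -x.2 / b j)|)) ∧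
    Integrable (fun x : (Fin m → ℝ) × ℝ => Eext a b f x * g x) ∧
    ∫ x : (Fin m → ℝ) × ℝ, Eext a b f x * g x =
      ∫ x in {x : (Fin m → ℝ) × ℝ | 0 < x.2},
        f x * (g x - ∑' j : ℤ, a j / (-(b j)) * g (x.1, -x.2 / b j)) := by
  obtain ⟨M, hM⟩ := hgb
  refine ⟨ae_summable_extension hb hab hf, fun x => ?_,
    integrable_and_integral_Eext_mul hb hab hf hg hM⟩
  refine Summable.of_nonneg_of_le (fun _ => abs_nonneg _) (fun j => ?_) (hab.mul_right M)
  rw [abs_mul, abs_div, abs_neg, abs_of_pos (hb j), div_eq_mul_inv]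
  exact mul_le_mul_of_nonneg_left (hM _) (mul_nonneg (abs_nonneg _) (inv_nonneg.2 (hb j).le))
end
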